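/- Let r > 0, set q = e^{−π√r}, assume k_r ∈ (0,1) satisfies K(√(1 − k_r²)) = √r · K(k_r), and let k'_r = √(1 − k_r²). Then ((−q^{1/2};q)_∞/(q^{1/2};q)_∞)² = k'_r/(1 − k_r). -/

import Mathlib

/-- The q-Pochhammer infinite product `(a; q)_∞ = ∏_{n=0}^∞ (1 - a qⁿ)`. -/
noncomputable def qPoch (a q : ℝ) : ℝ := ∏' n : ℕ, (1 - a * q ^ n)
/-- The complete elliptic integral of the first kind
`K(x) = ∫₀^{π/2} dt / √(1 - x² sin² t)`. -/
noncomputable def Kint (x : ℝ) : ℝ :=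
  ∫ t in (0 : ℝ)..(Real.pi / 2), 1 / Real.sqrt (1 - x ^ 2 * Real.sin t ^ 2)

open Filter Topology

noncomputable def qR (q : ℝ) : ℤ → ℝ
  | Int.ofNat m => (∏ j ∈ Finset.range m, (1 - q ^ (j + 1)))⁻¹
  | Int.negSucc _ => 0

lemma one_sub_pow_pos {q : ℝ} (h0 : 0 < q) (h1 : q < 1) (j : ℕ) : 0 < 1 - q ^ (j + 1) := by
  have : q ^ (j + 1) < 1 := pow_lt_one₀ h0.le h1 (Nat.succ_ne_zero j)
  linarith

lemma qR_rec {q : ℝ} (h0 : 0 < q) (h1 : q < 1) (m : ℤ) : qR q (m - 1) = (1 - q ^ m) * qR q m := by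
  rcases m with m | m
  · rcases m with _ | m
    · have : (Int.ofNat 0 - 1) = Int.negSucc 0 := rfl
      rw [this]; simp [qR]
    · have : (Int.ofNat (m+1) - 1) = Int.ofNat m := by simp
      rw [this]
      have h := one_sub_pow_pos h0 h1 m
      have h2 : ∏ j ∈ Finset.range m, (1 - q ^ (j + 1)) ≠ 0 :=
        Finset.prod_ne_zero_iff.2 fun j _ => (one_sub_pow_pos h0 h1 j).ne'
      simp only [qR, Finset.prod_range_succ, Int.ofNat_eq_natCast, zpow_natCast]
      field_simp
  · have : (Int.negSucc m - 1) = Int.negSucc (m + 1) := by omega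
    rw [this]; simp [qR]

lemma triple_alg (q x y A : ℝ) (hq : q ≠ 0) :
   (1-x*y/q)*(1-x*y)*A = (1+x*y/q)*((1-x)*(1-y)*A) + y*((1-x/q)*(1-x)*A)+ x*((1-y/q)*(1-y)*A) := by
  field_simp; ring

lemma finite_triple {p e : ℝ} (h0 : 0 < p) (h1 : p < 1) (he : e * e = 1) (n : ℕ) :
    HasSum (fun k : ℤ => e ^ k * p ^ (k ^ 2) * (qR (p ^ 2) (n + k) * qR (p ^ 2) (n - k)))
      ((∏ j ∈ Finset.range n, (1 + e * p * (p ^ 2) ^ j)) ^ 2 *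
        (∏ j ∈ Finset.range (2 * n), (1 - (p ^ 2) ^ (j + 1)))⁻¹) := by
  have hq0 : 0 < p ^ 2 := by positivity
  have hq1 : p ^ 2 < 1 := pow_lt_one₀ h0.le h1 two_ne_zero
  have he0 : e ≠ 0 := by rintro rfl; simp at he
  induction n with
  | zero =>
    convert hasSum_single (0 : ℤ) ?_ using 1
    · simp [qR]
    · intro k hk
      rcases k with k | k
      · rcases k with _ | k
        · simp at hk
        · have : (((0 : ℕ) : ℤ) - Int.ofNat (k+1)) = Int.negSucc k := by simp; omega
          rw [this]; simp [qR]
      · have : (((0 : ℕ) : ℤ) + Int.negSucc k) = Int.negSucc k := by simp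
        rw [this]; simp [qR]
  | succ n ih =>
    have i1 := (Equiv.subRight (1:ℤ)).hasSum_iff.2 ih
    have i2 := (Equiv.addRight (1:ℤ)).hasSum_iff.2 ih
    have i3 := (((ih.mul_left (1 + (p^2) ^ (2 * n + 1))).add (i1.mul_left (e * p ^ (2 * n + 1)))).add
      (i2.mul_left (e * p ^ (2 * n + 1)))).mul_left
      ((1 - (p^2)^(2*n+1)) * (1 - (p^2)^(2*n+2)))⁻¹
    convert i3 using 1
    · rfl
    · funext k
      simp only [Function.comp, Equiv.subRight_apply, Equiv.coe_addRight]
      clear i1 i2 i3 ih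
      set Q := p ^ 2 with hQ
      have hp : p ≠ 0 := h0.ne'
      have hQ' : Q ≠ 0 := hq0.ne'
      have r1 : qR Q (n + k) = (1 - Q ^ ((n:ℤ) + 1 + k)) * qR Q ((n:ℤ) + 1 + k) := by
        rw [← qR_rec hq0 hq1]; congr 1; ring
      have r2 : qR Q (n - k) = (1 - Q ^ ((n:ℤ) + 1 - k)) * qR Q ((n:ℤ) + 1 - k) := by
        rw [← qR_rec hq0 hq1]; congr 1; ring
      have r3 : qR Q (n + (k - 1)) = (1 - Q ^ ((n:ℤ) + 1 + k) / Q) * qR Q (n + k) := by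
        rw [div_eq_mul_inv, ← zpow_sub_one₀ hQ', show (n:ℤ) + 1 + k - 1 = n + k by ring, ← qR_rec hq0 hq1]
        congr 1; ring
      have r4 : qR Q (n - (k + 1)) = (1 - Q ^ ((n:ℤ) + 1 - k) / Q) * qR Q (n - k) := by
        rw [div_eq_mul_inv, ← zpow_sub_one₀ hQ', show (n:ℤ) + 1 - k - 1 = n - k by ring, ← qR_rec hq0 hq1]
        congr 1; ring
      have r5 : (n:ℤ) - (k - 1) = n + 1 - k := by ring
      have r6 : (n:ℤ) + (k + 1) = n + 1 + k := by ring
      have e1 : e * e ^ (k - 1) = e ^ k := by rw [zpow_sub_one₀ he0]; field_simp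
      have e2 : e * e ^ (k + 1) = e ^ k := by
        rw [zpow_add_one₀ he0, mul_comm, mul_assoc, he, mul_one]
      have p1 : p ^ (2 * n + 1) * p ^ ((k - 1) ^ 2) = p ^ (k ^ 2) * Q ^ ((n:ℤ) + 1 - k) := by
        rw [hQ, ← zpow_natCast p 2, ← zpow_mul, ← zpow_natCast, ← zpow_add₀ hp, ← zpow_add₀ hp]
        congr 1; push_cast; ring
      have p2 : p ^ (2 * n + 1) * p ^ ((k + 1) ^ 2) = p ^ (k ^ 2) * Q ^ ((n:ℤ) + 1 + k) := by
        rw [hQ, ← zpow_natCast p 2, ← zpow_mul, ← zpow_natCast, ← zpow_add₀ hp, ← zpow_add₀ hp]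
        congr 1; push_cast; ring
      have x2 : Q ^ (2 * n + 2) = Q ^ ((n:ℤ) + 1 + k) * Q ^ ((n:ℤ) + 1 - k) := by
        rw [← zpow_add₀ hQ', ← zpow_natCast]; congr 1; push_cast; ring
      have x1 : Q ^ (2 * n + 1) = Q ^ ((n:ℤ) + 1 + k) * Q ^ ((n:ℤ) + 1 - k) / Q := by
        rw [← x2, eq_div_iff hQ']; ring
      have n1 : 1 - Q ^ (2 * n + 1) ≠ 0 := (one_sub_pow_pos hq0 hq1 _).ne'
      have n2 : 1 - Q ^ (2 * n + 2) ≠ 0 := (one_sub_pow_pos hq0 hq1 _).ne'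
      rw [eq_inv_mul_iff_mul_eq₀ (mul_ne_zero n1 n2)]
      rw [r3, r4, r5, r6, r1, r2]
      push_cast
      have key := triple_alg Q (Q ^ ((n:ℤ) + 1 + k)) (Q ^ ((n:ℤ) + 1 - k))
        (qR Q ((n:ℤ) + 1 + k) * qR Q ((n:ℤ) + 1 - k)) hQ'
      rw [← x1, ← x2] at key
      have t1 : ∀ X, e * p ^ (2 * n + 1) * (e ^ (k - 1) * p ^ ((k - 1) ^ 2) * X)
          = e ^ k * (p ^ (k ^ 2) * Q ^ ((n:ℤ) + 1 - k)) * X := by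
        intro X; rw [← p1, ← e1]; ring
      have t2 : ∀ X, e * p ^ (2 * n + 1) * (e ^ (k + 1) * p ^ ((k + 1) ^ 2) * X)
          = e ^ k * (p ^ (k ^ 2) * Q ^ ((n:ℤ) + 1 + k)) * X := by
        intro X; rw [← p2, ← e2]; ring
      rw [t1, t2]
      linear_combination (e ^ k * p ^ (k ^ 2)) * key
    · rw [show 2 * (n+1) = 2 * n + 1 + 1 by ring, Finset.prod_range_succ, Finset.prod_range_succ, Finset.prod_range_succ]
      rw [mul_inv, mul_inv]
      have : (1 + e * p * (p^2)^n)^2 = 1 + (p^2)^(2*n+1) + e * p ^ (2 * n + 1) + e * p ^ (2 * n + 1) := by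
        have : (1 + e * p * (p^2)^n)^2 = 1 + (e * e) * (p^2)^(2*n+1) + e * p ^ (2 * n + 1) + e * p ^ (2 * n + 1) := by ring
        rw [this, he, one_mul]
      rw [mul_pow, this, mul_inv]
      ring

lemma summable_geo {q : ℝ} (h0 : 0 < q) (h1 : q < 1) : Summable fun n : ℕ => -q ^ (n + 1) :=
  ((summable_nat_add_iff 1).2 (summable_geometric_of_lt_one h0.le h1)).neg

lemma summable_pk {p : ℝ} (h0 : 0 < p) (h1 : p < 1) : Summable fun k : ℤ => p ^ (k ^ 2) := by
  have hg := summable_geometric_of_lt_one h0.le h1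
  have hn : Summable fun n : ℕ => p ^ ((n : ℤ) ^ 2) := by
    refine Summable.of_nonneg_of_le (fun n => by positivity) (fun n => ?_) hg
    have : p ^ ((n : ℤ) ^ 2) = p ^ (n ^ 2) := by rw [← zpow_natCast]; push_cast; rfl
    rw [this]
    exact pow_le_pow_of_le_one h0.le h1.le (Nat.le_self_pow two_ne_zero n)
  refine Summable.of_nat_of_neg hn ?_
  simpa using hn

lemma qR_natCast (q : ℝ) (m : ℕ) : qR q (m : ℤ) = (∏ j ∈ Finset.range m, (1 - q ^ (j + 1)))⁻¹ := rfl

lemma qR_facts {q : ℝ} (h0 : 0 < q) (h1 : q < 1) : ∃ c : ℝ, 0 < c ∧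
    Tendsto (fun m : ℕ => ∏ j ∈ Finset.range m, (1 - q ^ (j + 1))) atTop (𝓝 c) ∧
    Tendsto (qR q) atTop (𝓝 c⁻¹) ∧ ∀ m, |qR q m| ≤ c⁻¹ := by
  have hs := summable_geo h0 h1
  have hm := Real.multipliable_one_add_of_summable hs
  have ht := hm.tendsto_prod_tprod_nat
  have hne : ∏' n : ℕ, (1 + -q ^ (n + 1)) ≠ 0 := by
    refine tprod_one_add_ne_zero_of_summable (f := fun n : ℕ => -q ^ (n + 1)) ?_ ?_
    · intro n
      have := one_sub_pow_pos h0 h1 n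
      rw [← sub_eq_add_neg]
      exact this.ne'
    · exact hs.norm
  set c := ∏' n : ℕ, (1 + -q ^ (n + 1)) with hc
  simp only [← sub_eq_add_neg] at ht
  have hanti : Antitone (fun m : ℕ => ∏ j ∈ Finset.range m, (1 - q ^ (j + 1))) := by
    refine antitone_nat_of_succ_le fun m => ?_
    rw [Finset.prod_range_succ]
    refine mul_le_of_le_one_right (Finset.prod_nonneg fun j _ => (one_sub_pow_pos h0 h1 j).le) ?_
    have : 0 < q ^ (m + 1) := by positivity
    linarith
  have hpos : ∀ m : ℕ, 0 < ∏ j ∈ Finset.range m, (1 - q ^ (j + 1)) := fun m =>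
    Finset.prod_pos fun j _ => (one_sub_pow_pos h0 h1 j)
  have hc0 : 0 < c := lt_of_le_of_ne (ge_of_tendsto' ht fun m => (hpos m).le) hne.symm
  refine ⟨c, hc0, ht, ?_, ?_⟩
  · have h2 := ht.inv₀ hne
    rw [← Nat.map_cast_int_atTop, tendsto_map'_iff]
    exact h2
  · intro m
    rcases m with m | m
    · simp only [Int.ofNat_eq_natCast, qR_natCast]
      rw [abs_of_pos (inv_pos.2 (hpos m))]
      exact inv_anti₀ hc0 (hanti.le_of_tendsto ht m)
    · simp [qR, hc0.le]

lemma triple {p : ℝ} (h0 : 0 < p) (h1 : p < 1) : ∃ c : ℝ, 0 < c ∧ ∀ e : ℝ, e * e = 1 →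
    ∑' k : ℤ, e ^ k * p ^ (k ^ 2) = c * (∏' n : ℕ, (1 - (-e * p) * (p ^ 2) ^ n)) ^ 2 := by
  have hq0 : 0 < p ^ 2 := by positivity
  have hq1 : p ^ 2 < 1 := pow_lt_one₀ h0.le h1 two_ne_zero
  obtain ⟨c, hc0, hc1, hc2, hc3⟩ := qR_facts hq0 hq1
  refine ⟨c, hc0, fun e he => ?_⟩
  have hea : |e| = 1 := by
    rw [← sq_eq_sq₀ (abs_nonneg e) zero_le_one, sq_abs]; linarith
  have l1 : Tendsto (fun n : ℕ => ∑' k : ℤ, e ^ k * p ^ (k ^ 2) * (qR (p ^ 2) (n + k) * qR (p ^ 2) (n - k))) atTop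
      (𝓝 (∑' k : ℤ, e ^ k * p ^ (k ^ 2) * (c⁻¹ * c⁻¹))) := by
    refine tendsto_tsum_of_dominated_convergence
      (bound := fun k : ℤ => p ^ (k ^ 2) * (c⁻¹ * c⁻¹)) ((summable_pk h0 h1).mul_right _) ?_ ?_
    · intro k
      refine Tendsto.const_mul _ (Tendsto.mul (hc2.comp ?_) (hc2.comp ?_))
      · exact tendsto_atTop_add_const_right _ _ tendsto_natCast_atTop_atTop
      · exact tendsto_atTop_add_const_right _ (-k) tendsto_natCast_atTop_atTop
    · refine Eventually.of_forall fun n k => ?_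
      rw [Real.norm_eq_abs, abs_mul, abs_mul, abs_mul, abs_zpow, hea, one_zpow, one_mul,
        abs_of_pos (zpow_pos h0 _)]
      gcongr
      · exact hc3 _
      · exact hc3 _
  have hmul : Multipliable fun n : ℕ => (1 + e * p * (p ^ 2) ^ n) :=
    Real.multipliable_one_add_of_summable ((summable_geometric_of_lt_one hq0.le hq1).mul_left _)
  have l2 : Tendsto (fun n : ℕ => (∏ j ∈ Finset.range n, (1 + e * p * (p ^ 2) ^ j)) ^ 2 *
        (∏ j ∈ Finset.range (2 * n), (1 - (p ^ 2) ^ (j + 1)))⁻¹) atTop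
      (𝓝 ((∏' n : ℕ, (1 + e * p * (p ^ 2) ^ n)) ^ 2 * c⁻¹)) := by
    refine (hmul.tendsto_prod_tprod_nat.pow 2).mul ((hc1.comp ?_).inv₀ hc0.ne')
    exact tendsto_id.const_mul_atTop' two_pos
  have l3 := tendsto_nhds_unique l1 (l2.congr fun n => (finite_triple h0 h1 he n).tsum_eq.symm)
  rw [tsum_mul_right] at l3
  have : ∀ n : ℕ, (1 - (-e * p) * (p ^ 2) ^ n) = (1 + e * p * (p ^ 2) ^ n) := fun n => by ring
  simp only [this]
  field_simp at l3
  linarith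

lemma tsum_split {α β : Type*} (F : α → ℝ) (hF : Summable F) (i j : β → α)
    (hi : Function.Injective i) (hj : Function.Injective j)
    (hc : IsCompl (Set.range i) (Set.range j)) :
    ∑' a, F a = ∑' b, F (i b) + ∑' b, F (j b) := by
  have h1 : HasSum (F ∘ i) (∑' b, F (i b)) := (hF.comp_injective hi).hasSum
  have h2 : HasSum (F ∘ j) (∑' b, F (j b)) := (hF.comp_injective hj).hasSum
  have h1' := hi.hasSum_range_iff.2 h1
  have h2' := hj.hasSum_range_iff.2 h2
  exact (h1'.add_isCompl hc h2').tsum_eq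

lemma split1 (F : ℤ → ℝ) (hF : Summable F) :
    ∑' a, F a = ∑' b : ℤ, F (2 * b) + ∑' b : ℤ, F (2 * b + 1) := by
  refine tsum_split F hF (fun b => 2 * b) (fun b => 2 * b + 1) ?_ ?_ ?_
  · intro a b h; simp only at h; omega
  · intro a b h; simp only at h; omega
  · constructor
    · rw [Set.disjoint_left]
      rintro _ ⟨a, rfl⟩ ⟨b, h⟩
      simp only at h; omega
    · rw [codisjoint_iff_le_sup]
      intro x _
      rcases Int.even_or_odd' x with ⟨c, h | h⟩
      · exact Or.inl ⟨c, h.symm⟩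
      · exact Or.inr ⟨c, h.symm⟩

lemma split2 (F : ℤ × ℤ → ℝ) (hF : Summable F) :
    ∑' a, F a = ∑' b : ℤ × ℤ, F (b.1 + b.2, b.1 - b.2) + ∑' b : ℤ × ℤ, F (b.1 + b.2 + 1, b.1 - b.2) := by
  refine tsum_split F hF (fun b : ℤ × ℤ => (b.1 + b.2, b.1 - b.2)) (fun b : ℤ × ℤ => (b.1 + b.2 + 1, b.1 - b.2)) ?_ ?_ ?_
  · rintro ⟨a, b⟩ ⟨c, d⟩ h; simp only [Prod.mk.injEq] at h ⊢; omega
  · rintro ⟨a, b⟩ ⟨c, d⟩ h; simp only [Prod.mk.injEq] at h ⊢; omega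
  · constructor
    · rw [Set.disjoint_left]
      rintro _ ⟨a, rfl⟩ ⟨b, h⟩
      simp only [Prod.mk.injEq] at h; omega
    · rw [codisjoint_iff_le_sup]
      rintro ⟨x, y⟩ _
      rcases Int.even_or_odd' (x + y) with ⟨c, h | h⟩
      · refine Or.inl ⟨(c, x - c), ?_⟩
        simp only [Prod.mk.injEq]; omega
      · refine Or.inr ⟨(c, x - c - 1), ?_⟩
        simp only [Prod.mk.injEq]; omega

noncomputable def T3 (s : ℝ) : ℝ := ∑' k : ℤ, Real.exp (-Real.pi * s * (k:ℝ) ^ 2)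
noncomputable def T4 (s : ℝ) : ℝ := ∑' k : ℤ, (-1 : ℝ) ^ k * Real.exp (-Real.pi * s * (k:ℝ) ^ 2)
noncomputable def T2 (s : ℝ) : ℝ := ∑' k : ℤ, Real.exp (-Real.pi * s * ((k:ℝ) + 1 / 2) ^ 2)

lemma exp_eq_zpow (s : ℝ) (k : ℤ) : Real.exp (-Real.pi * s * (k:ℝ) ^ 2) = Real.exp (-Real.pi * s) ^ (k ^ 2) := by
  rw [← Real.rpow_intCast, ← Real.exp_mul]; push_cast; rfl

lemma exp_lt_one' {s : ℝ} (hs : 0 < s) : Real.exp (-Real.pi * s) < 1 := by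
  rw [Real.exp_lt_one_iff]
  have := mul_pos Real.pi_pos hs
  linarith

lemma sum3 {s : ℝ} (hs : 0 < s) : Summable fun k : ℤ => Real.exp (-Real.pi * s * (k:ℝ) ^ 2) := by
  simp only [exp_eq_zpow]
  exact summable_pk (Real.exp_pos _) (exp_lt_one' hs)

lemma neg_one_zpow_abs (k : ℤ) : |(-1 : ℝ) ^ k| = 1 := by simp [abs_zpow]

lemma sum4 {s : ℝ} (hs : 0 < s) : Summable fun k : ℤ => (-1 : ℝ) ^ k * Real.exp (-Real.pi * s * (k:ℝ) ^ 2) := by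
  refine Summable.of_norm ?_
  refine (sum3 hs).congr fun k => ?_
  rw [norm_mul, Real.norm_eq_abs, neg_one_zpow_abs, one_mul, Real.norm_eq_abs, abs_of_pos (Real.exp_pos _)]

lemma sum2 {s : ℝ} (hs : 0 < s) : Summable fun k : ℤ => Real.exp (-Real.pi * s * ((k:ℝ) + 1 / 2) ^ 2) := by
  have := (sum3 (s := s / 4) (by positivity)).comp_injective (i := fun k : ℤ => 2 * k + 1)
    (by intro a b h; simp only at h; omega)
  refine this.congr fun k => ?_
  simp only [Function.comp]
  congr 1; push_cast; ring

lemma sum2' {s : ℝ} (hs : 0 < s) : Summable fun k : ℤ => (-1 : ℝ) ^ k * Real.exp (-Real.pi * s * ((k:ℝ) + 1 / 2) ^ 2) := by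
  refine Summable.of_norm ?_
  refine (sum2 hs).congr fun k => ?_
  rw [norm_mul, Real.norm_eq_abs, neg_one_zpow_abs, one_mul, Real.norm_eq_abs, abs_of_pos (Real.exp_pos _)]

lemma T2'_zero (s : ℝ) : ∑' k : ℤ, (-1 : ℝ) ^ k * Real.exp (-Real.pi * s * ((k:ℝ) + 1 / 2) ^ 2) = 0 := by
  have h := (Equiv.subLeft (-1 : ℤ)).tsum_eq (fun k : ℤ => (-1 : ℝ) ^ k * Real.exp (-Real.pi * s * ((k:ℝ) + 1 / 2) ^ 2))
  have h2 : ∀ k : ℤ, (-1 : ℝ) ^ ((Equiv.subLeft (-1 : ℤ)) k) * Real.exp (-Real.pi * s * ((((Equiv.subLeft (-1 : ℤ)) k : ℤ):ℝ) + 1 / 2) ^ 2)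
      = -((-1 : ℝ) ^ k * Real.exp (-Real.pi * s * ((k:ℝ) + 1 / 2) ^ 2)) := by
    intro k
    simp only [Equiv.subLeft_apply]
    rw [zpow_sub₀ (by norm_num)]
    have : ((-1 : ℝ) ^ k)⁻¹ = (-1) ^ k := by rw [← inv_zpow]; norm_num
    rw [div_eq_mul_inv, this]
    have e : (((-1 - k : ℤ) : ℝ) + 1 / 2) ^ 2 = ((k:ℝ) + 1 / 2) ^ 2 := by push_cast; ring
    rw [e]
    norm_num
  simp only [h2, tsum_neg] at h
  linarith

lemma T3_split {s : ℝ} (hs : 0 < s) : T3 s = T3 (4 * s) + T2 (4 * s) := by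
  rw [T3, split1 _ (sum3 hs), T3, T2]
  congr 1 <;> refine tsum_congr fun k => ?_ <;> congr 1 <;> push_cast <;> ring

lemma T4_split {s : ℝ} (hs : 0 < s) : T4 s = T3 (4 * s) - T2 (4 * s) := by
  rw [T4, split1 _ (sum4 hs), T3, T2, sub_eq_add_neg, ← tsum_neg]
  have h1 : ∀ k : ℤ, (-1 : ℝ) ^ (2 * k) = 1 := fun k => by rw [zpow_mul]; norm_num
  congr 1 <;> refine tsum_congr fun k => ?_
  · rw [h1, one_mul]
    congr 1; push_cast; ring
  · rw [zpow_add₀ (by norm_num), h1, one_mul, zpow_one, neg_one_mul]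
    congr 2; push_cast; ring

lemma T3_mod {s : ℝ} (hs : 0 < s) : T3 s⁻¹ = Real.sqrt s * T3 s := by
  have h := Real.tsum_exp_neg_mul_int_sq hs
  rw [← Real.sqrt_eq_rpow] at h
  have h1 : T3 s = 1 / Real.sqrt s * T3 s⁻¹ := h
  have := Real.sqrt_pos.2 hs
  rw [h1]; field_simp

lemma T4_mod {s : ℝ} (hs : 0 < s) : T4 s⁻¹ = Real.sqrt s * T2 s := by
  have h1 := T3_split (inv_pos.2 hs)
  have h2 := T4_split (inv_pos.2 hs)
  have h3 := T3_split (s := s / 4) (by positivity)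
  have h4 := T3_mod hs
  have h5 := T3_mod (s := s / 4) (by positivity)
  have e1 : (s / 4)⁻¹ = 4 * s⁻¹ := by field_simp
  have e2 : Real.sqrt (s / 4) = Real.sqrt s / 2 := by
    rw [Real.sqrt_div hs.le, show (4:ℝ) = 2 ^ 2 by norm_num, Real.sqrt_sq (by norm_num)]
  have e3 : 4 * (s / 4) = s := by ring
  rw [e1, e2] at h5
  rw [e3] at h3
  rw [h3] at h5
  linear_combination h2 + h1 + 2 * h5 - h4

lemma T_A {s : ℝ} (hs : 0 < s) : T3 s ^ 2 = T3 (2 * s) ^ 2 + T2 (2 * s) ^ 2 := by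
  have hs2 : 0 < 2 * s := by positivity
  have n3 := (sum3 hs).norm
  have n3' := (sum3 hs2).norm
  have n2' := (sum2 hs2).norm
  rw [sq, sq, sq]
  unfold T3 T2
  rw [tsum_mul_tsum_of_summable_norm n3 n3, tsum_mul_tsum_of_summable_norm n3' n3',
    tsum_mul_tsum_of_summable_norm n2' n2', split2 _ (summable_mul_of_summable_norm n3 n3)]
  congr 1 <;> refine tsum_congr fun k => ?_ <;> simp only [← Real.exp_add] <;> congr 1 <;> push_cast <;> ring

lemma neg_one_zpow_sub (a b : ℤ) : (-1 : ℝ) ^ (a - b) = (-1) ^ a * (-1) ^ b := by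
  rw [zpow_sub₀ (by norm_num)]
  have : ((-1 : ℝ) ^ b)⁻¹ = (-1) ^ b := by rw [← inv_zpow]; norm_num
  rw [div_eq_mul_inv, this]

lemma neg_one_zpow_mul_self (b : ℤ) : (-1 : ℝ) ^ b * (-1) ^ b = 1 := by
  rw [← neg_one_zpow_sub]; simp

lemma T_B {s : ℝ} (hs : 0 < s) : T4 s ^ 2 = T3 (2 * s) ^ 2 - T2 (2 * s) ^ 2 := by
  have hs2 : 0 < 2 * s := by positivity
  have n3 := (sum4 hs).norm
  have n3' := (sum3 hs2).norm
  have n2' := (sum2 hs2).norm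
  rw [sq, sq, sq]
  unfold T3 T2 T4
  rw [tsum_mul_tsum_of_summable_norm n3 n3, tsum_mul_tsum_of_summable_norm n3' n3',
    tsum_mul_tsum_of_summable_norm n2' n2', split2 _ (summable_mul_of_summable_norm n3 n3),
    sub_eq_add_neg, ← tsum_neg]
  congr 1 <;> refine tsum_congr fun k => ?_
  · have h1 := neg_one_zpow_mul_self k.1
    have h2 := neg_one_zpow_mul_self k.2
    simp only
    rw [neg_one_zpow_sub, zpow_add₀ (by norm_num), mul_mul_mul_comm,
      show ∀ x y : ℝ, x * y * (x * y) = (x * x) * (y * y) by intros; ring, h1, h2, one_mul, one_mul,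
      ← Real.exp_add, ← Real.exp_add]
    congr 1; push_cast; ring
  · have h1 := neg_one_zpow_mul_self k.1
    have h2 := neg_one_zpow_mul_self k.2
    simp only
    rw [neg_one_zpow_sub, zpow_add₀ (by norm_num), zpow_add₀ (by norm_num), zpow_one, mul_mul_mul_comm,
      show ∀ x y : ℝ, x * y * (-1) * (x * y) = -((x * x) * (y * y)) by intros; ring, h1, h2, one_mul, neg_one_mul,
      ← Real.exp_add, ← Real.exp_add]
    congr 2; push_cast; ring

lemma T_C {s : ℝ} (hs : 0 < s) : T3 s * T4 s = T4 (2 * s) ^ 2 := by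
  have hs2 : 0 < 2 * s := by positivity
  have n3 := (sum3 hs).norm
  have n4 := (sum4 hs).norm
  have n4' := (sum4 hs2).norm
  have n2' := (sum2' hs2).norm
  have h0 := T2'_zero (2 * s)
  have : T4 (2 * s) ^ 2 = T4 (2 * s) * T4 (2 * s) +
      (∑' k : ℤ, (-1 : ℝ) ^ k * Real.exp (-Real.pi * (2 * s) * ((k:ℝ) + 1 / 2) ^ 2)) *
      ∑' k : ℤ, (-1 : ℝ) ^ k * Real.exp (-Real.pi * (2 * s) * ((k:ℝ) + 1 / 2) ^ 2) := by rw [h0]; ring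
  rw [this]
  unfold T3 T4
  rw [tsum_mul_tsum_of_summable_norm n3 n4, tsum_mul_tsum_of_summable_norm n4' n4',
    tsum_mul_tsum_of_summable_norm n2' n2', split2 _ (summable_mul_of_summable_norm n3 n4)]
  congr 1 <;> refine tsum_congr fun k => ?_
  · simp only
    rw [neg_one_zpow_sub, mul_mul_mul_comm ((-1 : ℝ) ^ k.1), mul_left_comm, ← Real.exp_add, ← Real.exp_add]
    congr 2; push_cast; ring
  · simp only
    rw [neg_one_zpow_sub, mul_mul_mul_comm ((-1 : ℝ) ^ k.1), mul_left_comm, ← Real.exp_add, ← Real.exp_add]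
    congr 2; push_cast; ring

lemma T3_pos {s : ℝ} (hs : 0 < s) : 0 < T3 s :=
  (sum3 hs).tsum_pos (fun _ => (Real.exp_pos _).le) 0 (Real.exp_pos _)
lemma T2_pos {s : ℝ} (hs : 0 < s) : 0 < T2 s :=
  (sum2 hs).tsum_pos (fun _ => (Real.exp_pos _).le) 0 (Real.exp_pos _)
lemma T4_pos {s : ℝ} (hs : 0 < s) : 0 < T4 s := by
  have := T4_mod (inv_pos.2 hs)
  rw [inv_inv] at this
  rw [this]
  exact mul_pos (Real.sqrt_pos.2 (inv_pos.2 hs)) (T2_pos (inv_pos.2 hs))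

lemma T_lim (e : ℝ) (he : |e| = 1) : Tendsto (fun s : ℝ => ∑' k : ℤ, e ^ k * Real.exp (-Real.pi * s * (k:ℝ) ^ 2)) atTop (𝓝 1) := by
  have h : (1 : ℝ) = ∑' k : ℤ, if k = 0 then 1 else 0 := by simp
  rw [h]
  refine tendsto_tsum_of_dominated_convergence (sum3 (s := 1) one_pos) ?_ ?_
  · intro k
    by_cases hk : k = 0
    · simp [hk]
    · simp only [hk, if_false]
      rw [← mul_zero (e ^ k)]
      refine Tendsto.const_mul _ (Real.tendsto_exp_atBot.comp ?_)
      have : 0 < Real.pi * (k:ℝ) ^ 2 := by positivity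
      have h2 := (tendsto_id (α := ℝ) (x := atTop)).const_mul_atTop this
      refine (tendsto_neg_atTop_atBot.comp h2).congr fun s => ?_
      simp only [Function.comp, id]; ring
  · filter_upwards [eventually_ge_atTop 1] with s hs k
    rw [norm_mul, Real.norm_eq_abs, abs_zpow, he, one_zpow, one_mul, Real.norm_eq_abs, abs_of_pos (Real.exp_pos _)]
    rw [Real.exp_le_exp]
    have : 0 ≤ Real.pi * (k:ℝ) ^ 2 := by positivity
    nlinarith

lemma T3_lim : Tendsto T3 atTop (𝓝 1) := by
  have := T_lim 1 (by simp)
  simp only [one_zpow, one_mul] at this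
  exact this
lemma T4_lim : Tendsto T4 atTop (𝓝 1) := T_lim (-1) (by simp)

noncomputable def EE (a b t : ℝ) : ℝ := a ^ 2 * Real.cos t ^ 2 + b ^ 2 * Real.sin t ^ 2
noncomputable def II (a b : ℝ) : ℝ := ∫ t in (0 : ℝ)..(Real.pi / 2), 1 / Real.sqrt (EE a b t)

lemma EE_lb {a b m : ℝ} (hm : 0 ≤ m) (ha : m ≤ a) (hb : m ≤ b) (t : ℝ) : m ^ 2 ≤ EE a b t := by
  have h := Real.sin_sq_add_cos_sq t
  have h1 : m ^ 2 ≤ a ^ 2 := by gcongr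
  have h2 : m ^ 2 ≤ b ^ 2 := by gcongr
  unfold EE
  nlinarith [sq_nonneg (Real.sin t), sq_nonneg (Real.cos t)]

lemma EE_ub {a b m : ℝ} (ha0 : 0 ≤ a) (hb0 : 0 ≤ b) (ha : a ≤ m) (hb : b ≤ m) (t : ℝ) : EE a b t ≤ m ^ 2 := by
  have h := Real.sin_sq_add_cos_sq t
  have h1 : a ^ 2 ≤ m ^ 2 := by gcongr
  have h2 : b ^ 2 ≤ m ^ 2 := by gcongr
  unfold EE
  nlinarith [sq_nonneg (Real.sin t), sq_nonneg (Real.cos t)]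

lemma EE_pos {a b : ℝ} (ha : 0 < a) (hb : 0 < b) (t : ℝ) : 0 < EE a b t := by
  have := EE_lb (m := min a b) (le_min ha.le hb.le) (min_le_left _ _) (min_le_right _ _) t
  have h2 : 0 < min a b := lt_min ha hb
  exact lt_of_lt_of_le (by positivity) this

lemma EE_cont (a b : ℝ) : Continuous (EE a b) := by unfold EE; fun_prop

lemma F_cont {a b : ℝ} (ha : 0 < a) (hb : 0 < b) : Continuous fun t => 1 / Real.sqrt (EE a b t) := by
  refine continuous_const.div (EE_cont a b).sqrt fun t => ?_
  exact (Real.sqrt_pos.2 (EE_pos ha hb t)).ne'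

lemma II_pi {a b : ℝ} (ha : 0 < a) (hb : 0 < b) :
    ∫ t in (0 : ℝ)..Real.pi, 1 / Real.sqrt (EE a b t) = 2 * II a b := by
  have hc := F_cont ha hb
  rw [← intervalIntegral.integral_add_adjacent_intervals (b := Real.pi / 2)
    (hc.intervalIntegrable _ _) (hc.intervalIntegrable _ _)]
  have : ∫ t in (Real.pi / 2)..Real.pi, 1 / Real.sqrt (EE a b t) = II a b := by
    have h := intervalIntegral.integral_comp_sub_left (a := 0) (b := Real.pi / 2)
      (fun t => 1 / Real.sqrt (EE a b t)) Real.pi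
    rw [sub_zero, show Real.pi - Real.pi / 2 = Real.pi / 2 by ring] at h
    rw [← h]
    unfold II EE
    simp only [Real.cos_pi_sub, Real.sin_pi_sub, neg_sq]
  rw [this]; unfold II; ring

noncomputable def ND (a b t : ℝ) : ℝ :=
  ((a - b) * (Real.sin t * Real.cos t)) / (a * Real.cos t ^ 2 + b * Real.sin t ^ 2)
noncomputable def ph (a b t : ℝ) : ℝ := 2 * t - Real.arctan (ND a b t)

lemma D_pos {a b : ℝ} (ha : 0 < a) (hb : 0 < b) (t : ℝ) : 0 < a * Real.cos t ^ 2 + b * Real.sin t ^ 2 := by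
  have := EE_pos (Real.sqrt_pos.2 ha) (Real.sqrt_pos.2 hb) t
  unfold EE at this
  rwa [Real.sq_sqrt ha.le, Real.sq_sqrt hb.le] at this

lemma one_add_ND {a b : ℝ} (ha : 0 < a) (hb : 0 < b) (t : ℝ) :
    1 + ND a b t ^ 2 = EE a b t / (a * Real.cos t ^ 2 + b * Real.sin t ^ 2) ^ 2 := by
  have hD := D_pos ha hb t
  have h := Real.sin_sq_add_cos_sq t
  have h2 : Real.sin t ^ 2 = 1 - Real.cos t ^ 2 := by linarith
  unfold ND EE
  rw [div_pow, mul_pow, mul_pow, eq_div_iff (by positivity), add_mul, div_mul_cancel₀ _ (by positivity), h2]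
  ring

lemma ph_deriv {a b : ℝ} (ha : 0 < a) (hb : 0 < b) (t : ℝ) :
    HasDerivAt (ph a b) ((a + b) * (a * Real.cos t ^ 2 + b * Real.sin t ^ 2) / EE a b t) t := by
  have hD := D_pos ha hb t
  have hE := EE_pos ha hb t
  have hs := Real.hasDerivAt_sin t
  have hc := Real.hasDerivAt_cos t
  have h1 := (((hs.mul hc).const_mul (a - b)).div (((hc.pow 2).const_mul a).add ((hs.pow 2).const_mul b)) hD.ne').arctan
  have h2 := ((hasDerivAt_id t).const_mul 2).sub h1
  refine HasDerivAt.congr_deriv (f := ph a b) h2 ?_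
  have h3 := one_add_ND ha hb t
  have e : ∀ X, 1 / (1 + ((((fun y => (a - b) * (Real.sin * Real.cos) y) / ((fun y => a * (Real.cos ^ 2) y) + fun y => b * (Real.sin ^ 2) y)) t)) ^ 2) * X = 1 / (1 + ND a b t ^ 2) * X := fun X => rfl
  rw [e, h3]
  have h := Real.sin_sq_add_cos_sq t
  simp
  field_simp
  unfold EE
  have h2 : Real.sin t ^ 2 = 1 - Real.cos t ^ 2 := by linarith
  rw [h2]
  ring

lemma ph_alg {a b : ℝ} (ha : 0 < a) (hb : 0 < b) (t : ℝ) :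
    EE ((a + b) / 2) (Real.sqrt (a * b)) (ph a b t) =
      ((a + b) / 2) ^ 2 * (a * Real.cos t ^ 2 + b * Real.sin t ^ 2) ^ 2 / EE a b t := by
  have hD := D_pos ha hb t
  have hE := EE_pos ha hb t
  have h3 := one_add_ND ha hb t
  have h := Real.sin_sq_add_cos_sq t
  have h2 : Real.sin t ^ 2 = 1 - Real.cos t ^ 2 := by linarith
  set D := (a * Real.cos t ^ 2 + b * Real.sin t ^ 2) with hDd
  have hq : Real.sqrt (1 + ND a b t ^ 2) = Real.sqrt (EE a b t) / D := by
    rw [h3, Real.sqrt_div hE.le, Real.sqrt_sq hD.le]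
  have hEs := Real.sqrt_pos.2 hE
  have hEq := Real.sq_sqrt hE.le
  have hcos : Real.cos (ph a b t) = (a * Real.cos t ^ 2 - b * Real.sin t ^ 2) / Real.sqrt (EE a b t) := by
    unfold ph
    rw [Real.cos_sub, Real.cos_arctan, Real.sin_arctan, hq, Real.cos_two_mul, Real.sin_two_mul]
    unfold ND
    rw [← hDd]
    field_simp
    rw [hDd, h2]
    have : Real.sin t ^ 2 = 1 - Real.cos t ^ 2 := by linarith
    ring_nf
    try rw [h2]
    try ring_nf
  have hsin : Real.sin (ph a b t) = (a + b) * Real.sin t * Real.cos t / Real.sqrt (EE a b t) := by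
    unfold ph
    rw [Real.sin_sub, Real.cos_arctan, Real.sin_arctan, hq, Real.cos_two_mul, Real.sin_two_mul]
    unfold ND
    rw [← hDd]
    field_simp
    rw [hDd]
    linear_combination (2 * b * Real.sin t * Real.cos t) * h
  have hab : Real.sqrt (a * b) ^ 2 = a * b := Real.sq_sqrt (by positivity)
  rw [EE, hcos, hsin, hab, div_pow, div_pow, hEq, hDd]
  field_simp
  rw [hEq]
  ring

lemma ph_zero (a b : ℝ) : ph a b 0 = 0 := by simp [ph, ND]
lemma ph_half (a b : ℝ) : ph a b (Real.pi / 2) = Real.pi := by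
  simp [ph, ND]; ring

lemma landen {a b : ℝ} (ha : 0 < a) (hb : 0 < b) : II ((a + b) / 2) (Real.sqrt (a * b)) = II a b := by
  have ha' : 0 < (a + b) / 2 := by positivity
  have hb' : 0 < Real.sqrt (a * b) := Real.sqrt_pos.2 (by positivity)
  have hc := F_cont ha' hb'
  have hsub := intervalIntegral.integral_comp_mul_deriv (a := 0) (b := Real.pi / 2)
    (f := ph a b) (f' := fun t => (a + b) * (a * Real.cos t ^ 2 + b * Real.sin t ^ 2) / EE a b t)
    (g := fun t => 1 / Real.sqrt (EE ((a + b) / 2) (Real.sqrt (a * b)) t))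
    (fun t _ => ph_deriv ha hb t)
    (by
      refine Continuous.continuousOn ?_
      exact Continuous.div (by fun_prop) (EE_cont a b) fun t => (EE_pos ha hb t).ne') hc
  rw [ph_zero, ph_half, II_pi ha' hb'] at hsub
  have : ∀ t, ((fun t => 1 / Real.sqrt (EE ((a + b) / 2) (Real.sqrt (a * b)) t)) ∘ ph a b) t *
      ((a + b) * (a * Real.cos t ^ 2 + b * Real.sin t ^ 2) / EE a b t) = 2 * (1 / Real.sqrt (EE a b t)) := by
    intro t
    have hD := D_pos ha hb t
    have hE := EE_pos ha hb t
    have hEs := Real.sqrt_pos.2 hE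
    have hEq := Real.sq_sqrt hE.le
    simp only [Function.comp]
    rw [ph_alg ha hb, Real.sqrt_div (by positivity), ← mul_pow, Real.sqrt_sq (by positivity)]
    nth_rewrite 2 [← hEq]
    field_simp
  simp only [this, intervalIntegral.integral_const_mul] at hsub
  unfold II at hsub ⊢
  linarith

lemma II_bounds {a b m M : ℝ} (hm : 0 < m) (ha : m ≤ a) (hb : m ≤ b) (ha' : a ≤ M) (hb' : b ≤ M) :
    Real.pi / 2 / M ≤ II a b ∧ II a b ≤ Real.pi / 2 / m := by
  have ha0 := hm.trans_le ha
  have hb0 := hm.trans_le hb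
  have hM : 0 < M := ha0.trans_le ha'
  have hc := F_cont ha0 hb0
  have hp : (0:ℝ) ≤ Real.pi / 2 := by positivity
  constructor
  · have := intervalIntegral.integral_mono_on (μ := MeasureTheory.volume) (f := fun _ => 1 / M) hp (continuous_const.intervalIntegrable _ _) (hc.intervalIntegrable _ _) fun t _ => by
      refine one_div_le_one_div_of_le (Real.sqrt_pos.2 (EE_pos ha0 hb0 t)) ?_
      rw [← Real.sqrt_sq hM.le]
      exact Real.sqrt_le_sqrt (EE_ub ha0.le hb0.le ha' hb' t)
    simp only [intervalIntegral.integral_const, sub_zero, smul_eq_mul, mul_one_div] at this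
    exact this
  · have := intervalIntegral.integral_mono_on (μ := MeasureTheory.volume) (g := fun _ => 1 / m) hp (hc.intervalIntegrable _ _) (continuous_const.intervalIntegrable _ _) fun t _ => by
      refine one_div_le_one_div_of_le hm ?_
      rw [← Real.sqrt_sq hm.le]
      exact Real.sqrt_le_sqrt (EE_lb hm.le ha hb t)
    simp only [intervalIntegral.integral_const, sub_zero, smul_eq_mul, mul_one_div] at this
    exact this

lemma II_lim {u v : ℕ → ℝ} (hu : Tendsto u atTop (𝓝 1)) (hv : Tendsto v atTop (𝓝 1)) :
    Tendsto (fun n => II (u n) (v n)) atTop (𝓝 (Real.pi / 2)) := by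
  have h1 : Tendsto (fun n => min (u n) (v n)) atTop (𝓝 1) := by simpa using hu.min hv
  have h2 : Tendsto (fun n => max (u n) (v n)) atTop (𝓝 1) := by simpa using hu.max hv
  have h3 : Tendsto (fun n => Real.pi / 2 / min (u n) (v n)) atTop (𝓝 (Real.pi / 2)) := by
    have := (tendsto_const_nhds (x := Real.pi / 2)).div h1 one_ne_zero
    rw [div_one] at this
    exact this
  have h4 : Tendsto (fun n => Real.pi / 2 / max (u n) (v n)) atTop (𝓝 (Real.pi / 2)) := by
    have := (tendsto_const_nhds (x := Real.pi / 2)).div h2 one_ne_zero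
    rw [div_one] at this
    exact this
  have h5 : ∀ᶠ n in atTop, 0 < min (u n) (v n) := h1.eventually_const_lt one_pos
  refine tendsto_of_tendsto_of_tendsto_of_le_of_le' h4 h3 ?_ ?_
  · filter_upwards [h5] with n hn
    exact (II_bounds hn (min_le_left _ _) (min_le_right _ _) (le_max_left _ _) (le_max_right _ _)).1
  · filter_upwards [h5] with n hn
    exact (II_bounds hn (min_le_left _ _) (min_le_right _ _) (le_max_left _ _) (le_max_right _ _)).2

lemma II_scale {a b c : ℝ} (hc : 0 < c) : II (c * a) (c * b) = c⁻¹ * II a b := by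
  unfold II
  rw [← intervalIntegral.integral_const_mul]
  refine intervalIntegral.integral_congr fun t _ => ?_
  have : EE (c * a) (c * b) t = c ^ 2 * EE a b t := by unfold EE; ring
  simp only [this]
  rw [Real.sqrt_mul (by positivity), Real.sqrt_sq hc.le, one_div, mul_inv, one_div]

lemma Kint_eq {k : ℝ} (hk : k ^ 2 ≤ 1) : Kint k = II 1 (Real.sqrt (1 - k ^ 2)) := by
  unfold Kint II
  refine intervalIntegral.integral_congr fun t _ => ?_
  have : 1 - k ^ 2 * Real.sin t ^ 2 = EE 1 (Real.sqrt (1 - k ^ 2)) t := by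
    unfold EE
    rw [Real.sq_sqrt (by linarith), Real.cos_sq']
    ring
  simp only [this]

lemma Kint_den_pos {k : ℝ} (h0 : 0 < k) (h1 : k < 1) (t : ℝ) : 0 < 1 - k ^ 2 * Real.sin t ^ 2 := by
  have h2 : k ^ 2 < 1 := pow_lt_one₀ h0.le h1 two_ne_zero
  have h3 := Real.sin_sq_le_one t
  nlinarith [sq_nonneg (Real.sin t), sq_nonneg k]

lemma Kint_cont {k : ℝ} (h0 : 0 < k) (h1 : k < 1) :
    Continuous fun t => 1 / Real.sqrt (1 - k ^ 2 * Real.sin t ^ 2) := by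
  refine continuous_const.div (by fun_prop) fun t => ?_
  exact (Real.sqrt_pos.2 (Kint_den_pos h0 h1 t)).ne'

lemma Kint_lt {k l : ℝ} (h0 : 0 < k) (h : k < l) (h1 : l < 1) : Kint k < Kint l := by
  have hl0 := h0.trans h
  have hk1 := h.trans h1
  have hkl : k ^ 2 < l ^ 2 := pow_lt_pow_left₀ h h0.le two_ne_zero
  unfold Kint
  refine intervalIntegral.integral_lt_integral_of_continuousOn_of_le_of_exists_lt (by positivity)
    (Kint_cont h0 hk1).continuousOn (Kint_cont hl0 h1).continuousOn (fun t _ => ?_)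
    ⟨Real.pi / 2, ⟨by positivity, le_rfl⟩, ?_⟩
  · refine one_div_le_one_div_of_le (Real.sqrt_pos.2 (Kint_den_pos hl0 h1 t)) (Real.sqrt_le_sqrt ?_)
    nlinarith [sq_nonneg (Real.sin t)]
  · refine one_div_lt_one_div_of_lt (Real.sqrt_pos.2 (Kint_den_pos hl0 h1 _))
      (Real.sqrt_lt_sqrt (Kint_den_pos hl0 h1 _).le ?_)
    rw [Real.sin_pi_div_two]; linarith

lemma II_step {s : ℝ} (hs : 0 < s) :
    II (T3 (2 * s) ^ 2) (T4 (2 * s) ^ 2) = II (T3 s ^ 2) (T4 s ^ 2) := by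
  have h3 := T3_pos hs
  have h4 := T4_pos hs
  rw [← landen (a := T3 s ^ 2) (b := T4 s ^ 2) (by positivity) (by positivity)]
  congr 1
  · have := T_A hs; have := T_B hs; linarith
  · rw [← mul_pow, Real.sqrt_sq (by positivity), T_C hs]

lemma II_T {s : ℝ} (hs : 0 < s) : II (T3 s ^ 2) (T4 s ^ 2) = Real.pi / 2 := by
  have h : ∀ n : ℕ, II (T3 (2 ^ n * s) ^ 2) (T4 (2 ^ n * s) ^ 2) = II (T3 s ^ 2) (T4 s ^ 2) := by
    intro n
    induction n with
    | zero => simp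
    | succ n ih =>
      rw [← ih, pow_succ' 2 n, mul_assoc]
      exact II_step (by positivity)
  have ht : Tendsto (fun n : ℕ => (2 : ℝ) ^ n * s) atTop atTop :=
    (tendsto_pow_atTop_atTop_of_one_lt one_lt_two).atTop_mul_const hs
  have l1 : Tendsto (fun n : ℕ => T3 (2 ^ n * s) ^ 2) atTop (𝓝 1) := by
    simpa using (T3_lim.comp ht).pow 2
  have l2 : Tendsto (fun n : ℕ => T4 (2 ^ n * s) ^ 2) atTop (𝓝 1) := by
    simpa using (T4_lim.comp ht).pow 2
  have l := II_lim l1 l2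
  simp only [h] at l
  exact tendsto_nhds_unique tendsto_const_nhds l

lemma II_T' {s : ℝ} (hs : 0 < s) : II (T3 s ^ 2) (T2 s ^ 2) = s * (Real.pi / 2) := by
  have h := II_T (inv_pos.2 hs)
  rw [T3_mod hs, T4_mod hs, mul_pow, mul_pow, Real.sq_sqrt hs.le, II_scale hs] at h
  rw [← h]; field_simp

lemma T_quartic {s : ℝ} (hs : 0 < s) : (T3 s ^ 2) ^ 2 - (T2 s ^ 2) ^ 2 = (T4 s ^ 2) ^ 2 := by
  have h2 : 0 < s / 2 := by positivity
  have e : 2 * (s / 2) = s := by ring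
  have a := T_A h2
  have b := T_B h2
  have c := T_C h2
  rw [e] at a b c
  rw [← c, mul_pow, a, b]; ring

lemma k_eq {s k : ℝ} (hs : 0 < s) (hk0 : 0 < k) (hk1 : k < 1)
    (hK : Kint (Real.sqrt (1 - k ^ 2)) = s * Kint k) : k = T2 s ^ 2 / T3 s ^ 2 := by
  have h3 := T3_pos hs
  have h2 := T2_pos hs
  have h4 := T4_pos hs
  have hq := T_quartic hs
  set k0 := T2 s ^ 2 / T3 s ^ 2 with hk
  set l0 := T4 s ^ 2 / T3 s ^ 2 with hl
  have hk00 : 0 < k0 := by positivity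
  have hl00 : 0 < l0 := by positivity
  have hkl : k0 ^ 2 + l0 ^ 2 = 1 := by
    rw [hk, hl, div_pow, div_pow, ← hq]; field_simp; ring
  have hk01 : k0 < 1 := by nlinarith
  have hl01 : l0 < 1 := by nlinarith
  have s1 : Real.sqrt (1 - k0 ^ 2) = l0 := by
    rw [show 1 - k0 ^ 2 = l0 ^ 2 by linarith, Real.sqrt_sq hl00.le]
  have s2 : Real.sqrt (1 - l0 ^ 2) = k0 := by
    rw [show 1 - l0 ^ 2 = k0 ^ 2 by linarith, Real.sqrt_sq hk00.le]
  have K1 : Kint k0 = T3 s ^ 2 * (Real.pi / 2) := by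
    rw [Kint_eq (by nlinarith), s1]
    have := II_scale (a := 1) (b := l0) (c := T3 s ^ 2) (by positivity)
    rw [mul_one, hl, mul_div_cancel₀ _ (by positivity), II_T hs, ← hl] at this
    rw [this]; field_simp
  have K2 : Kint l0 = T3 s ^ 2 * (s * (Real.pi / 2)) := by
    rw [Kint_eq (by nlinarith), s2]
    have := II_scale (a := 1) (b := k0) (c := T3 s ^ 2) (by positivity)
    rw [mul_one, hk, mul_div_cancel₀ _ (by positivity), II_T' hs, ← hk] at this
    rw [this]; field_simp
  have K3 : Kint (Real.sqrt (1 - k0 ^ 2)) = s * Kint k0 := by rw [s1, K1, K2]; ring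
  have hr : ∀ x y : ℝ, 0 < x → x < y → y < 1 →
      Kint (Real.sqrt (1 - x ^ 2)) = s * Kint x → Kint (Real.sqrt (1 - y ^ 2)) = s * Kint y → False := by
    intro x y hx hxy hy h1 h2
    have a := Kint_lt hx hxy hy
    have hxy2 : x ^ 2 < y ^ 2 := pow_lt_pow_left₀ hxy hx.le two_ne_zero
    have hy2 : y ^ 2 < 1 := pow_lt_one₀ (hx.trans hxy).le hy two_ne_zero
    have b := Kint_lt (k := Real.sqrt (1 - y ^ 2)) (l := Real.sqrt (1 - x ^ 2))
      (Real.sqrt_pos.2 (by linarith)) (Real.sqrt_lt_sqrt (by linarith) (by linarith))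
      (by rw [Real.sqrt_lt' one_pos]; nlinarith)
    rw [h1, h2] at b
    have := lt_of_mul_lt_mul_left b hs.le
    linarith
  rcases lt_trichotomy k k0 with h | h | h
  · exact (hr k k0 hk0 h hk01 hK K3).elim
  · exact h
  · exact (hr k0 k hk00 h hk1 K3 hK).elim

/-- Equation (26): `((-q^{1/2};q)_∞/(q^{1/2};q)_∞)² = k'_r/(1 - k_r)` with `q = e^{-π√r}`. -/
theorem stmt_15 (r : ℝ) (hr : 0 < r) (q : ℝ) (hq : q = Real.exp (-Real.pi * Real.sqrt r))
    (k : ℝ) (hk0 : 0 < k) (hk1 : k < 1)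
    (hK : Kint (Real.sqrt (1 - k ^ 2)) = Real.sqrt r * Kint k) :
    (qPoch (-(q ^ ((1 : ℝ) / 2))) q / qPoch (q ^ ((1 : ℝ) / 2)) q) ^ 2 =
      Real.sqrt (1 - k ^ 2) / (1 - k) := by
  set s := Real.sqrt r with hs
  have hs0 : 0 < s := Real.sqrt_pos.2 hr
  have hk := k_eq hs0 hk0 hk1 hK
  have hs2 : 0 < s / 2 := by positivity
  set p := Real.exp (-Real.pi * (s / 2)) with hp
  have hp0 : 0 < p := Real.exp_pos _
  have hp1 : p < 1 := exp_lt_one' hs2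
  have hqp : q = p ^ 2 := by
    rw [hq, hp, sq, ← Real.exp_add]; congr 1; ring
  have hsq : q ^ ((1 : ℝ) / 2) = p := by
    rw [← Real.sqrt_eq_rpow, hqp, Real.sqrt_sq hp0.le]
  obtain ⟨c, hc, ht⟩ := triple hp0 hp1
  have t3 : T3 (s / 2) = c * qPoch (-p) q ^ 2 := by
    have := ht 1 (by norm_num)
    simp only [one_zpow, one_mul, neg_one_mul] at this
    rw [qPoch, hqp, ← this, T3]
    exact tsum_congr fun k => exp_eq_zpow _ k
  have t4 : T4 (s / 2) = c * qPoch p q ^ 2 := by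
    have := ht (-1) (by norm_num)
    simp only [neg_neg, one_mul] at this
    rw [qPoch, hqp, ← this, T4]
    exact tsum_congr fun k => by rw [exp_eq_zpow]
  have h3 := T3_pos hs0
  have h3' := T3_pos hs2
  have h4' := T4_pos hs2
  have hne : qPoch p q ^ 2 ≠ 0 := by
    intro h; rw [h, mul_zero] at t4; linarith
  have hx : (qPoch (-p) q / qPoch p q) ^ 2 = T3 (s / 2) / T4 (s / 2) := by
    rw [t3, t4, div_pow, mul_div_mul_left _ _ hc.ne']
  rw [hsq, hx]
  have a := T_A hs2
  have b := T_B hs2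
  rw [show 2 * (s / 2) = s by ring] at a b
  have hk2 : T2 s ^ 2 = k * T3 s ^ 2 := by rw [hk]; field_simp
  have h1k : 0 < 1 - k := by linarith
  have h1k2 : 0 ≤ 1 - k ^ 2 := by nlinarith
  refine (sq_eq_sq₀ (by positivity) (by positivity)).1 ?_
  rw [div_pow, div_pow, Real.sq_sqrt h1k2, a, b, hk2]
  rw [div_eq_div_iff (by rw [← hk2, ← b]; positivity) (by positivity)]
  ring
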